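/- Let α > −1 and define 𝒵_p : ℝ² → ℝ by 𝒵_p(z) = (|z|^{2(1+α)} − 1)/(|z|^{2(1+α)} + 1). Then for every z ∈ ℝ² with z ≠ 0, 𝒵_p is twice differentiable at z and Δ𝒵_p(z) + (8(1+α)²|z|^{2α}/(1 + |z|^{2(1+α)})²) 𝒵_p(z) = 0. -/

import Mathlib

open MeasureTheory Real Set Filter

noncomputable section

abbrev Pt := EuclideanSpace ℝ (Fin 2)

/-- Coordinatewise Laplace operator on the plane. -/
def lap (u : Pt → ℝ) (x : Pt) : ℝ :=
  ∑ i : Fin 2, fderiv ℝ (fun y => fderiv ℝ u y (EuclideanSpace.single i 1)) x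
    (EuclideanSpace.single i 1)

/-- The Laplacian in the plane of a function of the squared norm. -/
lemma lap_comp_norm_sq {F F' : ℝ → ℝ} {F'' : ℝ} {z : Pt} (hz : z ≠ 0)
    (hF : ∀ t, 0 < t → HasDerivAt F (F' t) t) (hF' : HasDerivAt F' F'' (‖z‖ ^ 2)) :
    lap (fun w : Pt => F (‖w‖ ^ 2)) z = 4 * (‖z‖ ^ 2 * F'' + F' (‖z‖ ^ 2)) := by
  have hsq : ∀ y : Pt, HasFDerivAt (fun w : Pt => ‖w‖ ^ 2) (2 • innerSL ℝ y) y := fun y =>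
    (hasStrictFDerivAt_norm_sq y).hasFDerivAt
  have hinner : ∀ (y : Pt) (i : Fin 2), inner ℝ y (EuclideanSpace.single i (1 : ℝ)) = y i := by
    intro y i
    simp [EuclideanSpace.inner_single_right]
  have hfirst : ∀ i : Fin 2, (fun y : Pt => fderiv ℝ (fun w : Pt => F (‖w‖ ^ 2)) y
      (EuclideanSpace.single i 1)) =ᶠ[nhds z] fun y => F' (‖y‖ ^ 2) * (2 * y i) := by
    intro i
    filter_upwards [isOpen_ne.mem_nhds hz] with y hy
    have hpos : 0 < ‖y‖ ^ 2 := pow_pos (norm_pos_iff.mpr hy) 2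
    have h := (hF _ hpos).comp_hasFDerivAt y (hsq y)
    have h' : fderiv ℝ (fun w : Pt => F (‖w‖ ^ 2)) y = _ := h.fderiv
    rw [h']
    simp [hinner]
  have hsecond : ∀ i : Fin 2, fderiv ℝ (fun y : Pt => fderiv ℝ (fun w : Pt => F (‖w‖ ^ 2)) y
      (EuclideanSpace.single i 1)) z (EuclideanSpace.single i 1) =
      4 * (z i) ^ 2 * F'' + 2 * F' (‖z‖ ^ 2) := by
    intro i
    have hcoord : HasFDerivAt (fun y : Pt => 2 * y i)
        ((2 : ℝ) • (EuclideanSpace.proj i : Pt →L[ℝ] ℝ)) z :=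
      ((EuclideanSpace.proj i : Pt →L[ℝ] ℝ).hasFDerivAt).const_mul 2
    have h := (hF'.comp_hasFDerivAt z (hsq z)).mul hcoord
    have h' : fderiv ℝ (fun y : Pt => F' (‖y‖ ^ 2) * (2 * y i)) z = _ := h.fderiv
    rw [(hfirst i).fderiv_eq, h']
    simp [hinner]
    ring
  have hnorm : ‖z‖ ^ 2 = z 0 ^ 2 + z 1 ^ 2 := by
    simp [EuclideanSpace.norm_sq_eq, Fin.sum_univ_two]
  rw [lap, Fin.sum_univ_two, hsecond, hsecond, hnorm]
  ring

lemma hasDerivAt_rpow_sub_one_div_rpow_add_one (β : ℝ) {t : ℝ} (ht : 0 < t) :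
    HasDerivAt (fun s : ℝ => (s ^ β - 1) / (s ^ β + 1))
      (2 * β * t ^ (β - 1) / (t ^ β + 1) ^ 2) t := by
  have hp : HasDerivAt (fun s : ℝ => s ^ β) (β * t ^ (β - 1)) t :=
    hasDerivAt_rpow_const (Or.inl ht.ne')
  have hne : t ^ β + 1 ≠ 0 := by positivity
  refine ((hp.sub_const 1).div (hp.add_const 1) hne).congr_deriv ?_
  ring

lemma hasDerivAt_rpow_div_rpow_add_one_sq (β : ℝ) {t : ℝ} (ht : 0 < t) :
    HasDerivAt (fun s : ℝ => 2 * β * s ^ (β - 1) / (s ^ β + 1) ^ 2)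
      ((2 * β ^ 2 * t ^ (β - 1) * (1 - t ^ β) / (t ^ β + 1) ^ 3 -
        2 * β * t ^ (β - 1) / (t ^ β + 1) ^ 2) / t) t := by
  have hp : HasDerivAt (fun s : ℝ => s ^ β) (β * t ^ (β - 1)) t :=
    hasDerivAt_rpow_const (Or.inl ht.ne')
  have hq : HasDerivAt (fun s : ℝ => s ^ (β - 1)) ((β - 1) * t ^ (β - 1 - 1)) t :=
    hasDerivAt_rpow_const (Or.inl ht.ne')
  have hne : t ^ β + 1 ≠ 0 := by positivity
  refine ((hq.const_mul (2 * β)).div ((hp.add_const 1).pow 2) (pow_ne_zero 2 hne)).congr_deriv ?_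
  have h1 : t ^ β = t ^ (β - 1) * t := by
    rw [rpow_sub_one ht.ne']
    field_simp
  rw [Pi.pow_apply, rpow_sub_one ht.ne' (β - 1)]
  rw [h1] at hne ⊢
  generalize t ^ (β - 1) = q at *
  field_simp
  ring

/-- The radial kernel element `𝒵_p(z) = (|z|^{2(1+α)} - 1)/(|z|^{2(1+α)} + 1)` of the
linearized singular Liouville operator: away from the origin it is twice differentiable and
`Δ𝒵_p + 8(1+α)²|z|^{2α}(1 + |z|^{2(1+α)})^{-2} 𝒵_p = 0`. -/
theorem radial_kernel_equation (α : ℝ) (hα : -1 < α) :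
    ∀ z : Pt, z ≠ 0 →
      ContDiffAt ℝ 2
        (fun w : Pt => (‖w‖ ^ (2 * (1 + α)) - 1) / (‖w‖ ^ (2 * (1 + α)) + 1)) z ∧
      lap (fun w : Pt => (‖w‖ ^ (2 * (1 + α)) - 1) / (‖w‖ ^ (2 * (1 + α)) + 1)) z
          + 8 * (1 + α) ^ 2 * ‖z‖ ^ (2 * α) / (1 + ‖z‖ ^ (2 * (1 + α))) ^ 2 *
            ((‖z‖ ^ (2 * (1 + α)) - 1) / (‖z‖ ^ (2 * (1 + α)) + 1)) = 0 := by
  intro z hz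
  have hr : ∀ (w : Pt) (γ : ℝ), ‖w‖ ^ (2 * γ) = (‖w‖ ^ 2) ^ γ := by
    intro w γ
    rw [rpow_mul (norm_nonneg w), rpow_two]
  have ht : 0 < ‖z‖ ^ 2 := pow_pos (norm_pos_iff.mpr hz) 2
  simp only [hr]
  constructor
  · have hpow : ContDiffAt ℝ 2 (fun w : Pt => (‖w‖ ^ 2) ^ (1 + α)) z :=
      (contDiff_norm_sq ℝ).contDiffAt.rpow_const_of_ne ht.ne'
    have hne : (‖z‖ ^ 2) ^ (1 + α) + 1 ≠ 0 := by positivity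
    exact (hpow.sub contDiffAt_const).div (hpow.add contDiffAt_const) hne
  · rw [lap_comp_norm_sq hz (fun t ht => hasDerivAt_rpow_sub_one_div_rpow_add_one (1 + α) ht)
      (hasDerivAt_rpow_div_rpow_add_one_sq (1 + α) ht), add_sub_cancel_left]
    generalize ‖z‖ ^ 2 = t at *
    have hne : t ^ (1 + α) + 1 ≠ 0 := by positivity
    rw [add_comm 1 (t ^ (1 + α))]
    field_simp
    ring
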